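/- Let X be a complex Banach space and f : [0,∞) → X a Bochner measurable function with ‖f(s)‖ ≤ C for almost every s ≥ 0, where C > 0. Let M : [0,∞) → [1,∞) be continuous and monotone increasing, and assume there is an analytic function F̃ : Ω → X on the open set Ω = {z = x+iy ∈ ℂ : x > −1/M(|y|)} such that F̃(z) = ∫₀^∞ e^{-zs} f(s) ds for every z with Re(z) > 0, and ‖F̃(z)‖ ≤ M(|y|) for every z = x+iy with −1/M(|y|) < x ≤ 0. Then there exist K > 0 and T' ≥ 0 such that for every t > T' and every real a ≥ 1 satisfying M(a)(log a + log M(a) − ½ log(5C)) ≤ t/4, one has ‖∫₀ᵗ f(s) ds − F̃(0)‖ ≤ K/a. -/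

import Mathlib

open MeasureTheory Filter Set

lemma aux_arc_inv (p q R : ℝ) (hp : p < 0) (hq : 0 < q) (hR : 0 < R) :
    (∫ x : ℝ in p..q, ((x : ℂ) + (-R : ℝ) * Complex.I)⁻¹) -
      (∫ x : ℝ in p..q, ((x : ℂ) + R * Complex.I)⁻¹) +
      Complex.I • (∫ y : ℝ in (-R)..R, ((q : ℂ) + y * Complex.I)⁻¹) -
      Complex.I • (∫ y : ℝ in (-R)..R, ((p : ℂ) + y * Complex.I)⁻¹) = 2 * Real.pi * Complex.I := by
  have hor : ∀ c : ℝ, c ≠ 0 → (∫ x : ℝ in p..q, ((x : ℂ) + c * Complex.I)⁻¹)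
      = Complex.log (q + c * Complex.I) - Complex.log (p + c * Complex.I) := by
    intro c hc
    have hs : ∀ x : ℝ, (x : ℂ) + c * Complex.I ∈ Complex.slitPlane := by
      intro x; right; simpa using hc
    refine intervalIntegral.integral_eq_sub_of_hasDerivAt
      (f := fun x : ℝ => Complex.log (x + c * Complex.I)) ?_ ?_
    · intro x _
      have h1 : HasDerivAt (fun x : ℝ => (x : ℂ) + c * Complex.I) 1 x :=
        (Complex.ofRealCLM.hasDerivAt (x := x)).add_const _
      simpa using h1.clog_real (hs x)
    · apply Continuous.intervalIntegrable
      apply Continuous.inv₀ (by fun_prop)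
      intro x
      exact Complex.slitPlane_ne_zero (hs x)
  have ver : ∀ c : ℝ, 0 < c → Complex.I • (∫ y : ℝ in (-R)..R, ((c : ℂ) + y * Complex.I)⁻¹)
      = Complex.log (c + R * Complex.I) - Complex.log (c + (-R : ℝ) * Complex.I) := by
    intro c hc
    have hs : ∀ x : ℝ, (c : ℂ) + x * Complex.I ∈ Complex.slitPlane := by
      intro x; left; simpa using hc
    rw [← intervalIntegral.integral_smul]
    refine intervalIntegral.integral_eq_sub_of_hasDerivAt
      (f := fun x : ℝ => Complex.log (c + x * Complex.I)) ?_ ?_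
    · intro x _
      have h1 : HasDerivAt (fun x : ℝ => (c : ℂ) + x * Complex.I) (1 * Complex.I) x :=
        ((Complex.ofRealCLM.hasDerivAt (x := x)).mul_const _).const_add _
      simpa [div_eq_mul_inv] using h1.clog_real (hs x)
    · apply Continuous.intervalIntegrable
      simp only [smul_eq_mul]
      refine continuous_const.mul (?_ : Continuous fun x : ℝ => ((c : ℂ) + x * Complex.I)⁻¹)
      apply Continuous.inv₀ (by fun_prop)
      intro x
      exact Complex.slitPlane_ne_zero (hs x)
  have left : (∫ y : ℝ in (-R)..R, ((p : ℂ) + y * Complex.I)⁻¹)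
      = - ∫ y : ℝ in (-R)..R, (((-p : ℝ) : ℂ) + y * Complex.I)⁻¹ := by
    have := intervalIntegral.integral_comp_neg (a := -R) (b := R)
      (fun y : ℝ => (((-p : ℝ) : ℂ) + y * Complex.I)⁻¹)
    rw [neg_neg] at this
    rw [← this, ← intervalIntegral.integral_neg]
    congr 1; ext y
    rw [← inv_neg]; congr 1; push_cast; ring
  have e1 : Complex.log (((-p : ℝ) : ℂ) + (-R : ℝ) * Complex.I)
      = Complex.log (p + R * Complex.I) - Real.pi * Complex.I := by
    have : (((-p : ℝ) : ℂ) + (-R : ℝ) * Complex.I) = -(p + R * Complex.I) := by push_cast; ring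
    rw [this, Complex.log, Complex.log, norm_neg,
      Complex.arg_neg_eq_arg_sub_pi_of_im_pos (by simpa using hR)]
    push_cast; ring
  have e2 : Complex.log (((-p : ℝ) : ℂ) + R * Complex.I)
      = Complex.log (p + (-R : ℝ) * Complex.I) + Real.pi * Complex.I := by
    have : (((-p : ℝ) : ℂ) + R * Complex.I) = -(p + (-R : ℝ) * Complex.I) := by push_cast; ring
    rw [this, Complex.log, Complex.log, norm_neg,
      Complex.arg_neg_eq_arg_add_pi_of_im_neg (by simpa using hR)]
    push_cast; ring
  rw [left, smul_neg, hor (-R) (neg_ne_zero.2 hR.ne'), hor _ hR.ne', ver q hq, ver (-p) (by linarith), e1, e2]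
  ring

lemma aux_cauchy {X : Type*} [NormedAddCommGroup X] [NormedSpace ℂ X] [CompleteSpace X]
    (p q R : ℝ) (hp : p < 0) (hq : 0 < q) (hR : 0 < R) (G : ℂ → X)
    (hc : ContinuousOn G (Icc p q ×ℂ Icc (-R) R))
    (hd : ∀ z ∈ Ioo p q ×ℂ Ioo (-R) R, DifferentiableAt ℂ G z) :
    (∫ x : ℝ in p..q, ((x : ℂ) + (-R : ℝ) * Complex.I)⁻¹ • G (x + (-R : ℝ) * Complex.I)) -
      (∫ x : ℝ in p..q, ((x : ℂ) + R * Complex.I)⁻¹ • G (x + R * Complex.I)) +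
      Complex.I • (∫ y : ℝ in (-R)..R, ((q : ℂ) + y * Complex.I)⁻¹ • G (q + y * Complex.I)) -
      Complex.I • (∫ y : ℝ in (-R)..R, ((p : ℂ) + y * Complex.I)⁻¹ • G (p + y * Complex.I))
      = (2 * Real.pi * Complex.I : ℂ) • G 0 := by
  have hpq : p ≤ q := by linarith
  have hRR : -R ≤ R := by linarith
  have hopen : Ioo p q ×ℂ Ioo (-R) R ∈ nhds (0 : ℂ) :=
    (isOpen_Ioo.reProdIm isOpen_Ioo).mem_nhds (by simp [Complex.mem_reProdIm, *])
  have hnh : Icc p q ×ℂ Icc (-R) R ∈ nhds (0 : ℂ) := by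
    filter_upwards [hopen] with z hz
    exact ⟨Ioo_subset_Icc_self hz.1, Ioo_subset_Icc_self hz.2⟩
  have h0 := Complex.integral_boundary_rect_eq_zero_of_differentiable_on_off_countable
    (dslope G 0) ⟨p, -R⟩ ⟨q, R⟩ {0} (countable_singleton _)
    (by
      simp only [uIcc_of_le hpq, uIcc_of_le hRR]
      exact (continuousOn_dslope hnh).2 ⟨hc, hd 0 (mem_of_mem_nhds hopen)⟩)
    (by
      simp only [min_eq_left hpq, min_eq_left hRR, max_eq_right hpq, max_eq_right hRR]
      rintro z ⟨hz, hz0⟩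
      exact (differentiableAt_dslope_of_ne hz0).2 (hd z hz))
  simp only at h0
  have key : ∀ (u : ℝ → ℂ) (a b : ℝ), a ≤ b → Continuous u → (∀ x ∈ Icc a b, u x ≠ 0) →
      (∀ x ∈ Icc a b, u x ∈ Icc p q ×ℂ Icc (-R) R) →
      (∫ x in a..b, dslope G 0 (u x)) =
        (∫ x in a..b, (u x)⁻¹ • G (u x)) - (∫ x in a..b, (u x)⁻¹) • G 0 := by
    intro u a b hab hu hu0 hmem
    have hci : ContinuousOn (fun x => (u x)⁻¹) (Icc a b) := hu.continuousOn.inv₀ hu0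
    rw [← intervalIntegral.integral_smul_const, ← intervalIntegral.integral_sub]
    · apply intervalIntegral.integral_congr
      intro x hx
      rw [uIcc_of_le hab] at hx
      simp only
      rw [dslope_of_ne _ (hu0 x hx), slope_def_module, sub_zero, smul_sub]
    · apply ContinuousOn.intervalIntegrable
      rw [uIcc_of_le hab]
      exact hci.smul (hc.comp hu.continuousOn hmem)
    · apply ContinuousOn.intervalIntegrable
      rw [uIcc_of_le hab]
      exact hci.smul continuousOn_const
  rw [key (fun x : ℝ => (x : ℂ) + (-R : ℝ) * Complex.I) p q hpq (by fun_prop)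
      (fun x _ h => hR.ne' (by simpa using congrArg Complex.im h))
      (fun x hx => by simpa [Complex.mem_reProdIm, hRR] using hx),
    key (fun x : ℝ => (x : ℂ) + R * Complex.I) p q hpq (by fun_prop)
      (fun x _ h => hR.ne' (by simpa using congrArg Complex.im h))
      (fun x hx => by simpa [Complex.mem_reProdIm, hRR] using hx),
    key (fun y : ℝ => (q : ℂ) + y * Complex.I) (-R) R hRR (by fun_prop)
      (fun x _ h => hq.ne' (by simpa using congrArg Complex.re h))
      (fun x hx => by simpa [Complex.mem_reProdIm, hpq] using hx),
    key (fun y : ℝ => (p : ℂ) + y * Complex.I) (-R) R hRR (by fun_prop)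
      (fun x _ h => hp.ne (by simpa using congrArg Complex.re h))
      (fun x hx => by simpa [Complex.mem_reProdIm, hpq] using hx)] at h0
  rw [← aux_arc_inv p q R hp hq hR]
  rw [← sub_eq_zero, ← h0]
  simp only [smul_sub, sub_smul, add_smul, smul_eq_mul, mul_smul]
  abel

lemma aux_kernel (R : ℝ) (hR : 0 < R) (z : ℂ) (hx : |z.re| ≤ R) (hy : |z.im| ≤ R)
    (hb : |z.re| = R ∨ |z.im| = R) :
    ‖z⁻¹ * (1 + z ^ 2 / (R : ℂ) ^ 2)‖ ≤ 3 * |z.re| / R ^ 2 := by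
  have hRc : (R : ℂ) ≠ 0 := by exact_mod_cast hR.ne'
  have hzR : R ≤ ‖z‖ := by
    rcases hb with h | h
    · rw [← h]; exact Complex.abs_re_le_norm z
    · rw [← h]; exact Complex.abs_im_le_norm z
  have hx2 : z.re ^ 2 ≤ R ^ 2 := sq_le_sq' (abs_le.1 hx).1 (abs_le.1 hx).2
  have hy2 : z.im ^ 2 ≤ R ^ 2 := sq_le_sq' (abs_le.1 hy).1 (abs_le.1 hy).2
  have hN : ‖(R : ℂ) ^ 2 + z ^ 2‖ ≤ 3 * R * |z.re| := by
    refine (sq_le_sq₀ (norm_nonneg _) (by positivity)).1 ?_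
    rw [← Complex.normSq_eq_norm_sq, Complex.normSq_apply]
    have a1 : ((R : ℂ) ^ 2 + z ^ 2).re = R ^ 2 + z.re ^ 2 - z.im ^ 2 := by
      simp [pow_two]; ring
    have a2 : ((R : ℂ) ^ 2 + z ^ 2).im = 2 * z.re * z.im := by
      simp [pow_two]; ring
    rw [a1, a2, mul_pow, sq_abs]
    rcases hb with h | h
    · have h' : z.re ^ 2 = R ^ 2 := by rw [← sq_abs, h]
      nlinarith [mul_nonneg (sub_nonneg.2 hy2) (sq_nonneg z.im), mul_nonneg (sub_nonneg.2 hy2) (sq_nonneg R), sq_nonneg (R ^ 2)]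
    · have h' : z.im ^ 2 = R ^ 2 := by rw [← sq_abs, h]
      nlinarith [mul_nonneg (sub_nonneg.2 hx2) (sq_nonneg z.re), mul_nonneg (sq_nonneg R) (sq_nonneg z.re)]
  have e : z⁻¹ * (1 + z ^ 2 / (R : ℂ) ^ 2) = ((R : ℂ) ^ 2 + z ^ 2) / (z * (R : ℂ) ^ 2) := by
    have hz : z ≠ 0 := by
      rintro rfl; simp at hzR; linarith
    field_simp
  have hzp : 0 < ‖z‖ := hR.trans_le hzR
  rw [e, norm_div, norm_mul, norm_pow, Complex.norm_real, Real.norm_of_nonneg hR.le]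
  rw [div_le_div_iff₀ (by positivity) (by positivity)]
  have : 3 * R * |z.re| ≤ 3 * |z.re| * ‖z‖ := by
    nlinarith [abs_nonneg z.re]
  calc _ ≤ (3 * R * |z.re|) * R ^ 2 := by gcongr
    _ ≤ (3 * |z.re| * ‖z‖) * R ^ 2 := by gcongr
    _ = _ := by ring

lemma aux_bdry {X : Type*} [NormedAddCommGroup X] [NormedSpace ℂ X]
    (R t C : ℝ) (hR : 0 < R) (z : ℂ) (hx : |z.re| ≤ R) (hy : |z.im| ≤ R)
    (hb : |z.re| = R ∨ |z.im| = R) (v : X) (hv : |z.re| * ‖v‖ ≤ C * Real.exp (-(z.re * t))) :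
    ‖z⁻¹ • (Complex.exp (z * t) * (1 + z ^ 2 / (R : ℂ) ^ 2)) • v‖ ≤ 3 * C / R ^ 2 := by
  have hk := aux_kernel R hR z hx hy hb
  have e : z⁻¹ • (Complex.exp (z * t) * (1 + z ^ 2 / (R : ℂ) ^ 2)) • v
      = (z⁻¹ * (1 + z ^ 2 / (R : ℂ) ^ 2)) • (Complex.exp (z * t)) • v := by
    rw [smul_smul, smul_smul]; congr 1; ring
  have he : ‖Complex.exp (z * t)‖ = Real.exp (z.re * t) := by
    rw [Complex.norm_exp]; simp
  rw [e, norm_smul, norm_smul, he]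
  calc _ ≤ 3 * |z.re| / R ^ 2 * (Real.exp (z.re * t) * ‖v‖) := by gcongr
    _ = 3 * (|z.re| * ‖v‖) * Real.exp (z.re * t) / R ^ 2 := by ring
    _ ≤ 3 * (C * Real.exp (-(z.re * t))) * Real.exp (z.re * t) / R ^ 2 := by gcongr
    _ = 3 * C * (Real.exp (-(z.re * t)) * Real.exp (z.re * t)) / R ^ 2 := by ring
    _ = 3 * C / R ^ 2 := by rw [← Real.exp_add]; simp

section
variable {X : Type*} [NormedAddCommGroup X] [NormedSpace ℂ X]

lemma aux_norm_exp (z : ℂ) (s : ℝ) : ‖Complex.exp (-z * s)‖ = Real.exp (-z.re * s) := by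
  rw [Complex.norm_exp]; simp

lemma aux_bound_ae (f : ℝ → X) (C : ℝ)
    (hbd : ∀ᵐ s ∂(volume.restrict (Set.Ici (0 : ℝ))), ‖f s‖ ≤ C) (z : ℂ) (S : Set ℝ)
    (hS : S ⊆ Ici 0) :
    ∀ᵐ s : ℝ ∂(volume.restrict S), ‖Complex.exp (-z * s) • f s‖ ≤ C * Real.exp (-z.re * s) := by
  filter_upwards [ae_restrict_of_ae_restrict_of_subset hS hbd] with s hs
  rw [norm_smul, aux_norm_exp, mul_comm]
  gcongr

lemma aux_meas (f : ℝ → X) (hf : AEStronglyMeasurable f (volume.restrict (Set.Ici 0)))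
    (z : ℂ) (S : Set ℝ) (hS : S ⊆ Ici 0) :
    AEStronglyMeasurable (fun s : ℝ => Complex.exp (-z * s) • f s) (volume.restrict S) := by
  refine AEStronglyMeasurable.smul ?_ (hf.mono_measure (Measure.restrict_mono hS le_rfl))
  exact (by fun_prop : Continuous fun s : ℝ => Complex.exp (-z * s)).aestronglyMeasurable

lemma aux_left (f : ℝ → X) (C : ℝ) (hC : 0 < C)
    (hbd : ∀ᵐ s ∂(volume.restrict (Set.Ici (0 : ℝ))), ‖f s‖ ≤ C) (t : ℝ) (z : ℂ) (hz : z.re ≤ 0) :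
    |z.re| * ‖∫ s in Ioc 0 t, Complex.exp (-z * s) • f s‖ ≤ C * Real.exp (-(z.re * t)) := by
  rcases hz.lt_or_eq with hz | hz
  swap
  · rw [hz]; simp; positivity
  have hz' : 0 < -z.re := by linarith
  have hi : IntegrableOn (fun s : ℝ => C * Real.exp (-z.re * s)) (Iic t) :=
    (integrableOn_exp_mul_Iic hz' t).const_mul C
  have h1 : ‖∫ s in Ioc 0 t, Complex.exp (-z * s) • f s‖
      ≤ ∫ s in Ioc 0 t, C * Real.exp (-z.re * s) :=
    norm_integral_le_of_norm_le (hi.mono_set Ioc_subset_Iic_self)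
      (aux_bound_ae f C hbd z _ (fun s hs => hs.1.le))
  have h2 : ∫ s in Ioc 0 t, C * Real.exp (-z.re * s) ≤ ∫ s in Iic t, C * Real.exp (-z.re * s) :=
    setIntegral_mono_set hi (Eventually.of_forall fun s => by positivity)
      (Eventually.of_forall Ioc_subset_Iic_self)
  rw [integral_const_mul (μ := volume.restrict (Iic t)), integral_exp_mul_Iic hz'] at h2
  rw [abs_of_neg hz]
  calc _ ≤ -z.re * (C * (Real.exp (-z.re * t) / -z.re)) := by gcongr; exact h1.trans h2
    _ = _ := by
      have hne : z.re ≠ 0 := hz.ne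
      field_simp

lemma aux_lap_int (f : ℝ → X) (hf : AEStronglyMeasurable f (volume.restrict (Set.Ici 0)))
    (C : ℝ) (hbd : ∀ᵐ s ∂(volume.restrict (Set.Ici (0 : ℝ))), ‖f s‖ ≤ C) (z : ℂ) (hz : 0 < z.re) :
    IntegrableOn (fun s : ℝ => Complex.exp (-z * s) • f s) (Ioi 0) := by
  have hi : IntegrableOn (fun s : ℝ => C * Real.exp (-z.re * s)) (Ioi 0) :=
    (integrableOn_exp_mul_Ioi (by linarith) 0).const_mul C
  exact hi.mono' (aux_meas f hf z _ Ioi_subset_Ici_self) (aux_bound_ae f C hbd z _ Ioi_subset_Ici_self)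

lemma aux_right (f : ℝ → X) (hf : AEStronglyMeasurable f (volume.restrict (Set.Ici 0)))
    (C : ℝ) (hbd : ∀ᵐ s ∂(volume.restrict (Set.Ici (0 : ℝ))), ‖f s‖ ≤ C)
    (t : ℝ) (ht : 0 ≤ t) (z : ℂ) (hz : 0 < z.re) :
    |z.re| * ‖(∫ s in Ioi (0 : ℝ), Complex.exp (-z * s) • f s)
      - ∫ s in Ioc 0 t, Complex.exp (-z * s) • f s‖ ≤ C * Real.exp (-(z.re * t)) := by
  have hL := aux_lap_int f hf C hbd z hz
  have hsplit : (∫ s in Ioi (0 : ℝ), Complex.exp (-z * s) • f s)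
      = (∫ s in Ioc 0 t, Complex.exp (-z * s) • f s)
        + ∫ s in Ioi t, Complex.exp (-z * s) • f s := by
    rw [← setIntegral_union (Ioc_disjoint_Ioi le_rfl) measurableSet_Ioi
      (hL.mono_set Ioc_subset_Ioi_self) (hL.mono_set (Ioi_subset_Ioi ht)), Ioc_union_Ioi_eq_Ioi ht]
  rw [hsplit, add_sub_cancel_left]
  have hi : IntegrableOn (fun s : ℝ => C * Real.exp (-z.re * s)) (Ioi t) :=
    (integrableOn_exp_mul_Ioi (by linarith) t).const_mul C
  have h1 : ‖∫ s in Ioi t, Complex.exp (-z * s) • f s‖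
      ≤ ∫ s in Ioi t, C * Real.exp (-z.re * s) :=
    norm_integral_le_of_norm_le hi
      (aux_bound_ae f C hbd z _ (fun s hs => ht.trans (le_of_lt hs)))
  rw [integral_const_mul, integral_exp_mul_Ioi (by linarith)] at h1
  rw [abs_of_pos hz]
  calc _ ≤ z.re * (C * (-Real.exp (-z.re * t) / -z.re)) := by gcongr
    _ = _ := by field_simp

lemma aux_diff [CompleteSpace X] (f : ℝ → X)
    (hf : AEStronglyMeasurable f (volume.restrict (Set.Ici 0)))
    (C : ℝ) (hbd : ∀ᵐ s ∂(volume.restrict (Set.Ici (0 : ℝ))), ‖f s‖ ≤ C)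
    (t : ℝ) : Differentiable ℂ (fun z : ℂ => ∫ s in Ioc 0 t, Complex.exp (-z * s) • f s) := by
  intro z₀
  have hS : Ioc 0 t ⊆ Ici (0 : ℝ) := fun s hs => hs.1.le
  have key := hasDerivAt_integral_of_dominated_loc_of_deriv_le (𝕜 := ℂ)
    (μ := volume.restrict (Ioc 0 t)) (F := fun (z : ℂ) (s : ℝ) => Complex.exp (-z * s) • f s)
    (F' := fun (z : ℂ) (s : ℝ) => (Complex.exp (-z * s) * (-1 * s)) • f s)
    (x₀ := z₀) (s := Metric.ball z₀ 1)
    (bound := fun s => Real.exp ((‖z₀‖ + 1) * t) * t * C) (Metric.ball_mem_nhds _ one_pos)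
    (Eventually.of_forall fun z => aux_meas f hf z _ hS) ?_ ?_ ?_ ?_ ?_
  · exact key.2.differentiableAt
  · refine Integrable.mono' ?_ (aux_meas f hf z₀ _ hS) (aux_bound_ae f C hbd z₀ _ hS)
    exact (by fun_prop : Continuous fun s : ℝ => C * Real.exp (-z₀.re * s)).integrableOn_Ioc
  · refine AEStronglyMeasurable.smul ?_ (hf.mono_measure (Measure.restrict_mono hS le_rfl))
    exact (by fun_prop : Continuous fun s : ℝ =>
      Complex.exp (-z₀ * s) * (-1 * s)).aestronglyMeasurable
  · filter_upwards [ae_restrict_of_ae_restrict_of_subset hS hbd,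
      ae_restrict_mem measurableSet_Ioc] with s hs hst z hz
    have hs0 : 0 ≤ s := hst.1.le
    have hzn : ‖z‖ ≤ ‖z₀‖ + 1 := by
      have := norm_sub_norm_le z z₀
      rw [mem_ball_iff_norm] at hz
      linarith
    have hre : -z.re ≤ ‖z₀‖ + 1 := by
      have := (abs_le.1 (Complex.abs_re_le_norm z)).1
      linarith
    rw [norm_smul, norm_mul, aux_norm_exp]
    have h3 : ‖(-1 * s : ℂ)‖ ≤ t := by
      simp [abs_of_nonneg hs0, hst.2]
    have h4 : -z.re * s ≤ (‖z₀‖ + 1) * t := by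
      calc -z.re * s ≤ (‖z₀‖ + 1) * s := by gcongr
        _ ≤ _ := by gcongr; exact hst.2
    have ht0 : 0 ≤ t := hs0.trans hst.2
    gcongr
  · exact continuous_const.integrableOn_Ioc
  · refine Eventually.of_forall fun s z _ => ?_
    have h1 : HasDerivAt (fun z : ℂ => -z * (s : ℂ)) (-1 * s) z :=
      (hasDerivAt_id z).neg.mul_const _
    exact h1.cexp.smul_const (f s)
end

lemma aux_exp (C m a t : ℝ) (hC : 0 < C) (hm : 1 ≤ m) (ha : 1 ≤ a)
    (h : m * (Real.log a + Real.log m - Real.log (5 * C) / 2) ≤ t / 4) :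
    Real.exp (-(1 / (2 * m)) * t) ≤ 5 * C / (a * m) ^ 2 := by
  have hm0 : 0 < m := by linarith
  have ha0 : 0 < a := by linarith
  have h1 : Real.exp (Real.log (5 * C) - 2 * (Real.log a + Real.log m)) = 5 * C / (a * m) ^ 2 := by
    rw [Real.exp_sub, Real.exp_log (by positivity), ← Real.log_mul ha0.ne' hm0.ne', two_mul,
      Real.exp_add, Real.exp_log (by positivity), pow_two]
  rw [← h1]
  apply Real.exp_le_exp.2
  have h2 : -(1 / (2 * m)) * t = -(t / (2 * m)) := by ring
  have h3 : 2 * (Real.log a + Real.log m) - Real.log (5 * C) ≤ t / (2 * m) := by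
    rw [le_div_iff₀ (by positivity)]
    nlinarith
  rw [h2]; linarith

open MeasureTheory Filter Set

theorem stmt_9 {X : Type*} [NormedAddCommGroup X] [NormedSpace ℂ X] [CompleteSpace X]
    (f : ℝ → X) (hf : AEStronglyMeasurable f (volume.restrict (Set.Ici 0)))
    (C : ℝ) (hC : 0 < C)
    (hbd : ∀ᵐ s ∂(volume.restrict (Set.Ici (0 : ℝ))), ‖f s‖ ≤ C)
    (M : ℝ → ℝ) (hM1 : ∀ s : ℝ, 0 ≤ s → 1 ≤ M s)
    (hMcont : ContinuousOn M (Set.Ici 0)) (hMmono : MonotoneOn M (Set.Ici 0))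
    (F : ℂ → X)
    (hFanal : DifferentiableOn ℂ F {z : ℂ | -(1 / M |z.im|) < z.re})
    (hFlap : ∀ z : ℂ, 0 < z.re →
      F z = ∫ s in Set.Ioi (0 : ℝ), Complex.exp (-z * s) • f s)
    (hFbound : ∀ z : ℂ, -(1 / M |z.im|) < z.re → z.re ≤ 0 → ‖F z‖ ≤ M |z.im|) :
    ∃ K : ℝ, 0 < K ∧ ∃ T' : ℝ, 0 ≤ T' ∧
      ∀ t : ℝ, T' < t → ∀ a : ℝ, 1 ≤ a →
        M a * (Real.log a + Real.log (M a) - Real.log (5 * C) / 2) ≤ t / 4 →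
        ‖(∫ s in Set.Ioc (0 : ℝ) t, f s) - F 0‖ ≤ K / a := by
  refine ⟨84 * C + 2, by positivity, 0, le_rfl, ?_⟩
  intro t ht R hR1 hcond
  have hR : 0 < R := by linarith
  have hRR : -R ≤ R := by linarith
  have hm1 : 1 ≤ M R := hM1 R hR.le
  have hexp := aux_exp C (M R) R t hC hm1 hR1 hcond
  set m := M R with hm
  have hm0 : 0 < m := by linarith
  obtain ⟨d, hd⟩ : ∃ d, d = 1 / (2 * m) := ⟨_, rfl⟩
  rw [← hd] at hexp
  have hd0 : 0 < d := by rw [hd]; positivity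
  have hdm : d * m = 1 / 2 := by rw [hd]; field_simp
  have hd2 : d ≤ 1 / 2 := by nlinarith
  have hdR : d ≤ R := by linarith
  -- the strip lies in the domain
  have hMy : ∀ y : ℝ, |y| ≤ R → M |y| ≤ m := fun y hy =>
    hMmono (abs_nonneg y) hR.le hy
  have hdom : ∀ z : ℂ, -d ≤ z.re → |z.im| ≤ R → -(1 / M |z.im|) < z.re := by
    intro z hz hy
    have h1 := hMy _ hy
    have h0 : 0 < M |z.im| := by linarith [hM1 |z.im| (abs_nonneg _)]
    have h2 : 1 / m ≤ 1 / M |z.im| := one_div_le_one_div_of_le h0 h1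
    have h3 : d < 1 / m := by rw [lt_div_iff₀ hm0, hdm]; norm_num
    linarith
  have hFm : ∀ z : ℂ, -d ≤ z.re → z.re ≤ 0 → |z.im| ≤ R → ‖F z‖ ≤ m := fun z h1 h2 h3 =>
    (hFbound z (hdom z h1 h3) h2).trans (hMy _ h3)
  set g : ℂ → X := fun z => ∫ s in Ioc 0 t, Complex.exp (-z * s) • f s with hg
  have hgd : Differentiable ℂ g := aux_diff f hf C hbd t
  have hg0 : g 0 = ∫ s in Ioc (0 : ℝ) t, f s := by simp [hg]
  set h : ℂ → ℂ := fun z => Complex.exp (z * t) * (1 + z ^ 2 / (R : ℂ) ^ 2) with hh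
  have hhd : Differentiable ℂ h := by rw [hh]; fun_prop
  have hh0 : h 0 = 1 := by simp [hh]
  have hFc : ContinuousOn (fun z => h z • F z) (Icc (-d) R ×ℂ Icc (-R) R) := by
    refine hhd.continuous.continuousOn.smul (hFanal.continuousOn.mono ?_)
    rintro z ⟨hz1, hz2⟩
    exact hdom z hz1.1 (abs_le.2 hz2)
  have hFd : ∀ z ∈ Ioo (-d) R ×ℂ Ioo (-R) R, DifferentiableAt ℂ (fun z => h z • F z) z := by
    intro z hz
    refine (hhd z).smul (hFanal.differentiableAt ?_)
    filter_upwards [(isOpen_Ioo.reProdIm isOpen_Ioo).mem_nhds hz] with w hw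
    exact hdom w hw.1.1.le (abs_le.2 ⟨hw.2.1.le, hw.2.2.le⟩)
  have hGd : Differentiable ℂ (fun z => h z • g z) := hhd.smul hgd
  have cF := aux_cauchy (-d) R R (by linarith) hR hR (fun z => h z • F z) hFc hFd
  have cG := aux_cauchy (-R) R R (by linarith) hR hR (fun z => h z • g z)
    hGd.continuous.continuousOn (fun z _ => hGd z)
  simp only [hh0, one_smul] at cF cG
  -- integrability
  have iF : ∀ (u : ℝ → ℂ) (a b : ℝ), a ≤ b → Continuous u → (∀ x ∈ Icc a b, u x ≠ 0) →
      (∀ x ∈ Icc a b, u x ∈ Icc (-d) R ×ℂ Icc (-R) R) →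
      IntervalIntegrable (fun x => (u x)⁻¹ • h (u x) • F (u x)) volume a b := by
    intro u a b hab hu hu0 hmem
    apply ContinuousOn.intervalIntegrable
    rw [uIcc_of_le hab]
    exact (hu.continuousOn.inv₀ hu0).smul (hFc.comp hu.continuousOn hmem)
  have iG : ∀ (u : ℝ → ℂ) (a b : ℝ), a ≤ b → Continuous u → (∀ x ∈ Icc a b, u x ≠ 0) →
      IntervalIntegrable (fun x => (u x)⁻¹ • h (u x) • g (u x)) volume a b := by
    intro u a b hab hu hu0
    apply ContinuousOn.intervalIntegrable
    rw [uIcc_of_le hab]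
    exact (hu.continuousOn.inv₀ hu0).smul (hGd.continuous.comp hu).continuousOn
  -- pointwise bounds
  have bG : ∀ z : ℂ, z.re ≤ 0 → |z.re| ≤ R → |z.im| ≤ R → (|z.re| = R ∨ |z.im| = R) →
      ‖z⁻¹ • h z • g z‖ ≤ 3 * C / R ^ 2 := fun z hz h1 h2 h3 =>
    aux_bdry R t C hR z h1 h2 h3 (g z) (aux_left f C hC hbd t z hz)
  have bD : ∀ z : ℂ, 0 < z.re → |z.re| ≤ R → |z.im| ≤ R → (|z.re| = R ∨ |z.im| = R) →
      ‖z⁻¹ • h z • F z - z⁻¹ • h z • g z‖ ≤ 3 * C / R ^ 2 := by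
    intro z hz h1 h2 h3
    rw [← smul_sub, ← smul_sub]
    refine aux_bdry R t C hR z h1 h2 h3 (F z - g z) ?_
    rw [hFlap z hz]
    exact aux_right f hf C hbd t ht.le z hz
  have bF : ∀ z : ℂ, -d ≤ z.re → z.re ≤ 0 → |z.im| = R →
      ‖z⁻¹ • h z • F z‖ ≤ 3 * (1 / 2) / R ^ 2 := by
    intro z h1 h2 h3
    have habs : |z.re| ≤ d := abs_le.2 ⟨h1, by linarith⟩
    refine aux_bdry R t (1 / 2) hR z (habs.trans hdR) h3.le (Or.inr h3) (F z) ?_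
    have e1 : 1 ≤ Real.exp (-(z.re * t)) := Real.one_le_exp (by nlinarith)
    calc |z.re| * ‖F z‖ ≤ d * m := by
          gcongr; exact hFm z h1 h2 h3.le
      _ ≤ _ := by rw [hdm]; linarith
  have bL : ∀ z : ℂ, z.re = -d → |z.im| ≤ R →
      ‖z⁻¹ • h z • F z‖ ≤ 30 * C / R ^ 2 := by
    intro z h1 h2
    have n1 : ‖F z‖ ≤ m := hFm z h1.ge (by linarith) h2
    have n2 : ‖z⁻¹‖ ≤ 2 * m := by
      rw [norm_inv]
      have : d ≤ ‖z‖ := by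
        have := Complex.abs_re_le_norm z
        rwa [h1, abs_neg, abs_of_pos hd0] at this
      calc ‖z‖⁻¹ ≤ d⁻¹ := by gcongr
        _ = 2 * m := by rw [hd]; simp
    have n3 : ‖1 + z ^ 2 / (R : ℂ) ^ 2‖ ≤ 3 := by
      have : ‖z‖ ^ 2 ≤ 2 * R ^ 2 := by
        rw [← Complex.normSq_eq_norm_sq, Complex.normSq_apply, h1]
        nlinarith [abs_mul_abs_self z.im, abs_nonneg z.im]
      calc _ ≤ ‖(1 : ℂ)‖ + ‖z ^ 2 / (R : ℂ) ^ 2‖ := norm_add_le _ _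
        _ = 1 + ‖z‖ ^ 2 / R ^ 2 := by simp
        _ ≤ 1 + 2 := by
          gcongr
          rw [div_le_iff₀ (by positivity)]; exact this
        _ = 3 := by norm_num
    have n4 : ‖Complex.exp (z * t)‖ ≤ 5 * C / (R * m) ^ 2 := by
      rw [Complex.norm_exp]
      simpa [h1] using hexp
    rw [norm_smul, norm_smul, hh, norm_mul]
    calc _ ≤ (2 * m) * ((5 * C / (R * m) ^ 2 * 3) * m) := by gcongr
      _ = 30 * C / R ^ 2 := by field_simp; norm_num
  -- splitting of horizontal integrals
  have hor : ∀ c : ℝ, |c| = R →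
      ‖(∫ x : ℝ in (-d)..R, ((x : ℂ) + c * Complex.I)⁻¹ • h (x + c * Complex.I) •
          F (x + c * Complex.I)) -
        (∫ x : ℝ in (-R)..R, ((x : ℂ) + c * Complex.I)⁻¹ • h (x + c * Complex.I) •
          g (x + c * Complex.I))‖ ≤ (6 * C + 1) / R := by
    intro c hc
    have hne : ∀ x : ℝ, (x : ℂ) + c * Complex.I ≠ 0 := by
      intro x hx
      have := congrArg Complex.im hx
      simp at this
      rw [this] at hc; simp at hc; linarith
    have hcm := abs_le.1 hc.le
    have hu : Continuous fun x : ℝ => (x : ℂ) + c * Complex.I := by fun_prop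
    have i1 := iF (fun x : ℝ => (x : ℂ) + c * Complex.I) (-d) 0 (by linarith) hu
      (fun x _ => hne x) (fun x hx => by
        simp only [Complex.mem_reProdIm, mem_Icc] at hx ⊢
        simp; exact ⟨⟨by linarith, by linarith⟩, by linarith, by linarith⟩)
    have i2 := iF (fun x : ℝ => (x : ℂ) + c * Complex.I) 0 R (by linarith) hu
      (fun x _ => hne x) (fun x hx => by
        simp only [Complex.mem_reProdIm, mem_Icc] at hx ⊢
        simp; exact ⟨⟨by linarith, by linarith⟩, by linarith, by linarith⟩)
    have i3 := iG (fun x : ℝ => (x : ℂ) + c * Complex.I) (-R) 0 (by linarith) hu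
      (fun x _ => hne x)
    have i4 := iG (fun x : ℝ => (x : ℂ) + c * Complex.I) 0 R (by linarith) hu
      (fun x _ => hne x)
    rw [← intervalIntegral.integral_add_adjacent_intervals i1 i2,
      ← intervalIntegral.integral_add_adjacent_intervals i3 i4, add_sub_add_comm,
      ← intervalIntegral.integral_sub i2 i4]
    have k1 : ‖∫ x : ℝ in (-d)..0, ((x : ℂ) + c * Complex.I)⁻¹ • h (x + c * Complex.I) •
          F (x + c * Complex.I)‖ ≤ 3 * (1 / 2) / R ^ 2 * |0 - -d| := by
      apply intervalIntegral.norm_integral_le_of_norm_le_const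
      intro x hx
      rw [uIoc_of_le (by linarith)] at hx
      apply bF
      · simpa using hx.1.le
      · simpa using hx.2
      · simpa using hc
    have k2 : ‖∫ x : ℝ in (-R)..0, ((x : ℂ) + c * Complex.I)⁻¹ • h (x + c * Complex.I) •
          g (x + c * Complex.I)‖ ≤ 3 * C / R ^ 2 * |0 - -R| := by
      apply intervalIntegral.norm_integral_le_of_norm_le_const
      intro x hx
      rw [uIoc_of_le (by linarith)] at hx
      apply bG
      · simpa using hx.2
      · simpa using abs_le.2 ⟨hx.1.le, hx.2.trans hR.le⟩
      · simpa using hc.le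
      · right; simpa using hc
    have k3 : ‖∫ x : ℝ in (0 : ℝ)..R, (((x : ℂ) + c * Complex.I)⁻¹ • h (x + c * Complex.I) •
          F (x + c * Complex.I) - ((x : ℂ) + c * Complex.I)⁻¹ • h (x + c * Complex.I) •
          g (x + c * Complex.I))‖ ≤ 3 * C / R ^ 2 * |R - 0| := by
      apply intervalIntegral.norm_integral_le_of_norm_le_const
      intro x hx
      rw [uIoc_of_le (by linarith)] at hx
      apply bD
      · simpa using hx.1
      · simpa using abs_le.2 ⟨by linarith [hx.1], hx.2⟩
      · simpa using hc.le
      · right; simpa using hc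
    have r1 : 3 * (1 / 2) / R ^ 2 * |0 - -d| ≤ 1 / R := by
      rw [zero_sub, neg_neg, abs_of_pos hd0]
      rw [div_mul_eq_mul_div, div_le_div_iff₀ (by positivity) hR]
      nlinarith
    have r2 : 3 * C / R ^ 2 * |0 - -R| = 3 * C / R := by
      rw [zero_sub, neg_neg, abs_of_pos hR]; field_simp
    have r3 : 3 * C / R ^ 2 * |R - 0| = 3 * C / R := by
      rw [sub_zero, abs_of_pos hR]; field_simp
    rw [r2] at k2
    rw [r3] at k3
    have r4 : (6 * C + 1) / R = 1 / R + 3 * C / R + 3 * C / R := by ring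
    rw [r4]
    refine (norm_add_le _ _).trans ?_
    refine add_le_add ((norm_sub_le _ _).trans ?_) k3
    linarith
  have hver : ‖(∫ y : ℝ in (-R)..R, ((R : ℂ) + y * Complex.I)⁻¹ • h (R + y * Complex.I) •
        F (R + y * Complex.I)) - (∫ y : ℝ in (-R)..R, ((R : ℂ) + y * Complex.I)⁻¹ •
        h (R + y * Complex.I) • g (R + y * Complex.I))‖ ≤ 6 * C / R := by
    have hne : ∀ x : ℝ, (R : ℂ) + x * Complex.I ≠ 0 := by
      intro x hx
      have := congrArg Complex.re hx
      simp at this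
      linarith
    have hu : Continuous fun x : ℝ => (R : ℂ) + x * Complex.I := by fun_prop
    rw [← intervalIntegral.integral_sub
      (iF (fun x : ℝ => (R : ℂ) + x * Complex.I) (-R) R hRR hu (fun x _ => hne x) (fun x hx => by
        simp only [Complex.mem_reProdIm, mem_Icc] at hx ⊢
        simp; exact ⟨by linarith, hx⟩))
      (iG (fun x : ℝ => (R : ℂ) + x * Complex.I) (-R) R hRR hu (fun x _ => hne x))]
    have k : ‖∫ y : ℝ in (-R)..R, (((R : ℂ) + y * Complex.I)⁻¹ • h (R + y * Complex.I) •
        F (R + y * Complex.I) - ((R : ℂ) + y * Complex.I)⁻¹ •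
        h (R + y * Complex.I) • g (R + y * Complex.I))‖ ≤ 3 * C / R ^ 2 * |R - -R| := by
      apply intervalIntegral.norm_integral_le_of_norm_le_const
      intro x hx
      rw [uIoc_of_le hRR] at hx
      apply bD
      · simpa using hR
      · simp [abs_of_pos hR]
      · simpa using abs_le.2 ⟨hx.1.le, hx.2⟩
      · left; simp [abs_of_pos hR]
    refine k.trans (le_of_eq ?_)
    rw [sub_neg_eq_add, abs_of_pos (by positivity)]
    field_simp; norm_num
  have hLg : ‖∫ y : ℝ in (-R)..R, (((-R : ℝ) : ℂ) + y * Complex.I)⁻¹ •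
        h ((-R : ℝ) + y * Complex.I) • g ((-R : ℝ) + y * Complex.I)‖ ≤ 6 * C / R := by
    have k : ‖∫ y : ℝ in (-R)..R, (((-R : ℝ) : ℂ) + y * Complex.I)⁻¹ •
        h ((-R : ℝ) + y * Complex.I) • g ((-R : ℝ) + y * Complex.I)‖
          ≤ 3 * C / R ^ 2 * |R - -R| := by
      apply intervalIntegral.norm_integral_le_of_norm_le_const
      intro x hx
      rw [uIoc_of_le hRR] at hx
      apply bG
      · simpa using hR.le
      · simp [abs_of_pos hR]
      · simpa using abs_le.2 ⟨hx.1.le, hx.2⟩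
      · left; simp [abs_of_pos hR]
    refine k.trans (le_of_eq ?_)
    rw [sub_neg_eq_add, abs_of_pos (by positivity)]
    field_simp; norm_num
  have hLF : ‖∫ y : ℝ in (-R)..R, (((-d : ℝ) : ℂ) + y * Complex.I)⁻¹ •
        h ((-d : ℝ) + y * Complex.I) • F ((-d : ℝ) + y * Complex.I)‖ ≤ 60 * C / R := by
    have k : ‖∫ y : ℝ in (-R)..R, (((-d : ℝ) : ℂ) + y * Complex.I)⁻¹ •
        h ((-d : ℝ) + y * Complex.I) • F ((-d : ℝ) + y * Complex.I)‖
          ≤ 30 * C / R ^ 2 * |R - -R| := by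
      apply intervalIntegral.norm_integral_le_of_norm_le_const
      intro x hx
      rw [uIoc_of_le hRR] at hx
      apply bL
      · simp
      · simpa using abs_le.2 ⟨hx.1.le, hx.2⟩
    refine k.trans (le_of_eq ?_)
    rw [sub_neg_eq_add, abs_of_pos (by positivity)]
    field_simp; norm_num
  have hB := hor (-R) (by rw [abs_neg, abs_of_pos hR])
  have hT := hor R (abs_of_pos hR)
  -- assembling
  have fin : ∀ B B' T T' V V' L L' : X,
      B - T + Complex.I • V - Complex.I • L = (2 * Real.pi * Complex.I : ℂ) • F 0 →
      B' - T' + Complex.I • V' - Complex.I • L' = (2 * Real.pi * Complex.I : ℂ) • g 0 →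
      ‖B - B'‖ ≤ (6 * C + 1) / R → ‖T - T'‖ ≤ (6 * C + 1) / R → ‖V - V'‖ ≤ 6 * C / R →
      ‖L'‖ ≤ 6 * C / R → ‖L‖ ≤ 60 * C / R → ‖g 0 - F 0‖ ≤ (84 * C + 2) / R := by
    intro B B' T T' V V' L L' e1 e2 b1 b2 b3 b4 b5
    have e3 : (2 * Real.pi * Complex.I : ℂ) • (F 0 - g 0)
        = (B - B') - (T - T') + Complex.I • (V - V') - Complex.I • L + Complex.I • L' := by
      rw [smul_sub, ← e1, ← e2, smul_sub]; abel
    have e4 : ‖(2 * Real.pi * Complex.I : ℂ)‖ = 2 * Real.pi := by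
      simp [abs_of_pos Real.pi_pos]
    have e5 := congrArg norm e3
    rw [norm_smul, e4] at e5
    have hI : ∀ v : X, ‖Complex.I • v‖ = ‖v‖ := fun v => by rw [norm_smul]; simp
    have e6 : ‖(B - B') - (T - T') + Complex.I • (V - V') - Complex.I • L + Complex.I • L'‖
        ≤ ‖B - B'‖ + ‖T - T'‖ + ‖V - V'‖ + ‖L‖ + ‖L'‖ := by
      rw [← hI (V - V'), ← hI L, ← hI L']
      refine (norm_add_le _ _).trans ?_
      gcongr
      refine (norm_sub_le _ _).trans ?_
      gcongr
      refine (norm_add_le _ _).trans ?_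
      gcongr
      exact norm_sub_le _ _
    have e7 : (84 * C + 2) / R = (6 * C + 1) / R + (6 * C + 1) / R + 6 * C / R + 60 * C / R
        + 6 * C / R := by ring
    rw [norm_sub_rev, e7]
    have := Real.pi_gt_three
    nlinarith [norm_nonneg (F 0 - g 0)]
  rw [← hg0]
  exact fin _ _ _ _ _ _ _ _ cF cG hB hT hver hLg hLF
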